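/- For all t in the open interval (1, 2^{1/6}), arsinh(√(t⁶-1)) - 3·√(t⁶-1)/((4/5)·t³ + 3·(1/5)·t + 8/5) > 0. -/

import Mathlib

/-- The function `t ↦ arsinh √(t⁶ - 1) - 3 √(t⁶ - 1) / (4/5 t³ + 3/5 t + 8/5)` is strictly
increasing on `[1, ∞)`. -/
lemma strictMonoOn_arsinh_sqrt_sub_div :
    StrictMonoOn (fun t : ℝ => Real.arsinh (Real.sqrt (t ^ 6 - 1)) -
      3 * Real.sqrt (t ^ 6 - 1) / ((4/5) * t ^ 3 + 3 * (1/5) * t + 8/5)) (Set.Ici 1) := by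
  refine strictMonoOn_of_deriv_pos (convex_Ici 1) ?_ ?_
  · refine ContinuousOn.sub ?_ (ContinuousOn.div ?_ ?_ ?_)
    · exact (Real.continuous_arsinh.comp (by fun_prop)).continuousOn
    · fun_prop
    · fun_prop
    · intro t ht
      have h : (0 : ℝ) < t := zero_lt_one.trans_le ht
      positivity
  · intro t ht
    rw [interior_Ici, Set.mem_Ioi] at ht
    have ht0 : 0 < t := zero_lt_one.trans ht
    have hrad : 0 < t ^ 6 - 1 := sub_pos.2 (one_lt_pow₀ ht (by norm_num))
    have hs : 0 < Real.sqrt (t ^ 6 - 1) := Real.sqrt_pos.2 hrad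
    have hsq : Real.sqrt (t ^ 6 - 1) ^ 2 = t ^ 6 - 1 := Real.sq_sqrt hrad.le
    have hD : 0 < (4/5) * t ^ 3 + 3 * (1/5) * t + 8/5 := by positivity
    have hcosh : Real.sqrt (1 + Real.sqrt (t ^ 6 - 1) ^ 2) = t ^ 3 := by
      rw [hsq, show 1 + (t ^ 6 - 1) = (t ^ 3) ^ 2 by ring, Real.sqrt_sq (by positivity)]
    have dsqrt := (((hasDerivAt_id t).pow 6).sub_const 1).sqrt hrad.ne'
    have dden := ((((hasDerivAt_id t).pow 3).const_mul (4/5 : ℝ)).add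
      ((hasDerivAt_id t).const_mul (3 * (1/5) : ℝ))).add_const (8/5 : ℝ)
    have d := dsqrt.arsinh.sub ((dsqrt.const_mul 3).div dden hD.ne')
    have hP : 0 < (t - 1) ^ 3 * (300 + 759 * (t - 1) + 804 * (t - 1) ^ 2 + 442 * (t - 1) ^ 3
        + 128 * (t - 1) ^ 4 + 16 * (t - 1) ^ 5) := by
      have hu : 0 < t - 1 := sub_pos.2 ht
      positivity
    refine lt_of_lt_of_eq ?_ d.deriv.symm
    simp only [id, Pi.pow_apply, Pi.add_apply, hcosh, smul_eq_mul]
    set s := Real.sqrt (t ^ 6 - 1)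
    refine lt_of_lt_of_eq (div_pos (mul_pos (by norm_num : (0 : ℝ) < 3 / 25) hP)
      (mul_pos hs (pow_pos hD 2))) ?_
    field_simp
    ring_nf
    rw [hsq]
    ring

theorem stmt_8 (t : ℝ) (ht : t ∈ Set.Ioo 1 ((2 : ℝ) ^ ((1 : ℝ)/6))) :
    Real.arsinh (Real.sqrt (t ^ 6 - 1)) -
      3 * Real.sqrt (t ^ 6 - 1) / ((4/5) * t ^ 3 + 3 * (1/5) * t + 8/5) > 0 := by
  simpa using strictMonoOn_arsinh_sqrt_sub_div Set.self_mem_Ici (Set.mem_Ici.2 ht.1.le) ht.1
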